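/- Let X ⊆ ℝⁿ be an open convex set, u : ℝⁿ → ℝ a C² function whose Hessian D²u(x) is positive definite for every x ∈ X, and let f, g : ℝⁿ → ℝ be continuous with g strictly positive and f vanishing outside X. Suppose the map ∇u transports f to g, i.e., for every Borel set B ⊆ ℝⁿ, ∫_{(∇u)⁻¹(B)} f(x) dx = ∫_B g(y) dy. Then u satisfies the Monge–Ampère equation: det(D²u(x)) = f(x)/g(∇u(x)) for every x ∈ X. -/

import Mathlib

open MeasureTheory Set RealInnerProductSpace

/-- A continuous linear endomorphism with positive definite quadratic form has positive
determinant. -/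
theorem ContinuousLinearMap.det_toLinearMap_pos_of_forall_inner_pos
    {E : Type*} [NormedAddCommGroup E] [InnerProductSpace ℝ E] [FiniteDimensional ℝ E]
    (A : E →L[ℝ] E) (hA : ∀ v : E, v ≠ 0 → 0 < ⟪A v, v⟫) :
    0 < LinearMap.det A.toLinearMap := by
  let P : ℝ → E →L[ℝ] E := fun t => (1 - t) • ContinuousLinearMap.id ℝ E + t • A
  have hP : Continuous fun t => (P t).det :=
    ContinuousLinearMap.continuous_det.comp (by fun_prop)
  have hne : ∀ t ∈ Icc (0 : ℝ) 1, (P t).det ≠ 0 := by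
    intro t ht h0
    obtain ⟨v, hv, hv0⟩ := (Submodule.ne_bot_iff _).1
      (LinearMap.bot_lt_ker_of_det_eq_zero (f := (P t).toLinearMap) h0).ne'
    have hin : ⟪P t v, v⟫ = (1 - t) * ⟪v, v⟫ + t * ⟪A v, v⟫ := by
      simp [P, inner_add_left, real_inner_smul_left]
    have hPv : P t v = 0 := hv
    rw [hPv, inner_zero_left] at hin
    have h1 := hA v hv0
    have h2 : 0 < ⟪v, v⟫ := real_inner_self_pos.2 hv0
    rcases ht.1.eq_or_lt with rfl | h
    · linarith
    · nlinarith [mul_pos h h1, mul_nonneg (sub_nonneg.2 ht.2) h2.le]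
  have h0 : (P 0).det = 1 := by
    simp only [P, sub_zero, one_smul, zero_smul, add_zero]
    exact LinearMap.det_id
  have h1 : (P 1).det = LinearMap.det A.toLinearMap := by
    simp only [P, sub_self, one_smul, zero_smul, zero_add]
  rw [← h1]
  by_contra hle
  obtain ⟨t, ht, hzero⟩ := intermediate_value_Icc' zero_le_one hP.continuousOn
    (show (0 : ℝ) ∈ Icc (P 1).det (P 0).det from ⟨not_lt.1 hle, by rw [h0]; exact zero_le_one⟩)
  exact hne t ht hzero

/-- A vector field on a convex set whose derivative is positive definite is injective. -/
theorem Convex.injOn_of_hasFDerivAt_inner_pos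
    {E : Type*} [NormedAddCommGroup E] [InnerProductSpace ℝ E] {s : Set E} (hs : Convex ℝ s)
    {F : E → E} {F' : E → E →L[ℝ] E} (hF : ∀ x ∈ s, HasFDerivAt F (F' x) x)
    (hpos : ∀ x ∈ s, ∀ v : E, v ≠ 0 → 0 < ⟪F' x v, v⟫) : InjOn F s := by
  intro x hx y hy hxy
  by_contra hne
  have hv : y - x ≠ 0 := sub_ne_zero.2 (Ne.symm hne)
  have hmem : ∀ t ∈ Icc (0 : ℝ) 1, x + t • (y - x) ∈ s := fun t ht =>
    hs.add_smul_sub_mem hx hy ht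
  have hder : ∀ t ∈ Icc (0 : ℝ) 1, HasDerivAt (fun t : ℝ => ⟪F (x + t • (y - x)), y - x⟫)
      ⟪F' (x + t • (y - x)) (y - x), y - x⟫ t := by
    intro t ht
    have hline : HasDerivAt (fun t : ℝ => x + t • (y - x)) (y - x) t := by
      simpa using ((hasDerivAt_id t).smul_const (y - x)).const_add x
    have h := ((hF _ (hmem t ht)).comp_hasDerivAt t hline).inner ℝ (hasDerivAt_const t (y - x))
    simpa using h
  obtain ⟨t, ht, heq⟩ := exists_hasDerivAt_eq_slope
    (fun t : ℝ => ⟪F (x + t • (y - x)), y - x⟫) _ zero_lt_one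
    (fun t ht => (hder t ht).continuousAt.continuousWithinAt)
    (fun t ht => hder t (Ioo_subset_Icc_self ht))
  have hp := hpos _ (hmem t (Ioo_subset_Icc_self ht)) _ hv
  rw [heq] at hp
  simp [hxy] at hp

/-- A mass-preserving gradient map with convex potential satisfies the
Monge–Ampère equation.  Let `X ⊆ ℝⁿ` be open and convex, `u` a `C²` function
with gradient `Du` and Hessian `Hu` positive definite on `X`, `f, g` continuous
with `g > 0` and `f = 0` outside `X`.  If `∇u` transports `f` to `g`, then
`det(D²u(x)) = f(x)/g(∇u(x))` for every `x ∈ X`. -/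
theorem mass_preserving_gradient_solves_monge_ampere (n : ℕ)
    (X : Set (EuclideanSpace ℝ (Fin n))) (hXopen : IsOpen X) (hXconv : Convex ℝ X)
    (u : EuclideanSpace ℝ (Fin n) → ℝ) (hu : ContDiff ℝ 2 u)
    (Du : EuclideanSpace ℝ (Fin n) → EuclideanSpace ℝ (Fin n))
    (hDu : ∀ x, HasGradientAt u (Du x) x)
    (Hu : EuclideanSpace ℝ (Fin n) →
      EuclideanSpace ℝ (Fin n) →L[ℝ] EuclideanSpace ℝ (Fin n))
    (hHu : ∀ x, HasFDerivAt Du (Hu x) x)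
    (hHupos : ∀ x ∈ X, ∀ v : EuclideanSpace ℝ (Fin n), v ≠ 0 → 0 < ⟪(Hu x) v, v⟫)
    (f g : EuclideanSpace ℝ (Fin n) → ℝ)
    (hfc : Continuous f) (hgc : Continuous g) (hgpos : ∀ y, 0 < g y)
    (hfout : ∀ x ∉ X, f x = 0)
    (htransport : ∀ B : Set (EuclideanSpace ℝ (Fin n)), MeasurableSet B →
      (∫ x in Du ⁻¹' B, f x) = ∫ y in B, g y) :
    ∀ x ∈ X, LinearMap.det (Hu x).toLinearMap = f x / g (Du x) := by
  have hDeq : Du = fun x => (InnerProductSpace.toDual ℝ _).symm (fderiv ℝ u x) := by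
    funext x
    rw [(hDu x).hasFDerivAt.fderiv, LinearIsometryEquiv.symm_apply_apply]
  have hDC : ContDiff ℝ 1 Du := by
    rw [hDeq]
    exact (InnerProductSpace.toDual ℝ _).symm.contDiff.comp
      (hu.fderiv_right (by norm_num [one_add_one_eq_two]))
  have hHc : Continuous Hu := by
    have : Hu = fderiv ℝ Du := funext fun x => (hHu x).fderiv.symm
    rw [this]
    exact hDC.continuous_fderiv one_ne_zero
  have hinj : InjOn Du X := hXconv.injOn_of_hasFDerivAt_inner_pos (fun x _ => hHu x) hHupos
  have hhc : Continuous fun x => |(Hu x).det| * g (Du x) :=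
    (ContinuousLinearMap.continuous_det.comp hHc).abs.mul (hgc.comp hDC.continuous)
  have hset : ∀ A ⊆ X, MeasurableSet A →
      ∫ x in A, f x = ∫ x in A, |(Hu x).det| * g (Du x) := by
    intro A hAX hA
    have hderiv : ∀ x ∈ A, HasFDerivWithinAt Du (Hu x) A x := fun x _ =>
      (hHu x).hasFDerivWithinAt
    have hAinj := hinj.mono hAX
    have himage := measurable_image_of_fderivWithin hA hderiv hAinj
    have hpre : ∫ x in Du ⁻¹' (Du '' A), f x = ∫ x in A, f x := by
      refine setIntegral_eq_of_subset_of_forall_sdiff_eq_zero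
        (hDC.continuous.measurable himage) (subset_preimage_image Du A) ?_
      rintro x ⟨⟨a, ha, hax⟩, hxA⟩
      refine hfout x fun hxX => hxA ?_
      rwa [← hinj (hAX ha) hxX hax]
    rw [← hpre, htransport _ himage,
      integral_image_eq_integral_abs_det_fderiv_smul volume hA hderiv hAinj]
    rfl
  intro x hx
  obtain ⟨r, hr, hball⟩ := Metric.nhds_basis_closedBall.mem_iff.1 (hXopen.mem_nhds hx)
  have hint : ∀ φ : EuclideanSpace ℝ (Fin n) → ℝ, Continuous φ →
      IntegrableOn φ (Metric.ball x r) := fun φ hφ =>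
    (hφ.continuousOn.integrableOn_compact (isCompact_closedBall x r)).mono_set
      Metric.ball_subset_closedBall
  have hae : f =ᵐ[volume.restrict (Metric.ball x r)] fun x => |(Hu x).det| * g (Du x) := by
    refine Integrable.ae_eq_of_forall_setIntegral_eq _ _ (hint _ hfc) (hint _ hhc) ?_
    intro A hA _
    rw [Measure.restrict_restrict hA]
    exact hset _ ((inter_subset_right.trans Metric.ball_subset_closedBall).trans hball)
      (hA.inter measurableSet_ball)
  have hfx := Measure.eqOn_open_of_ae_eq hae Metric.isOpen_ball hfc.continuousOn
    hhc.continuousOn (Metric.mem_ball_self hr)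
  have hdet := (Hu x).det_toLinearMap_pos_of_forall_inner_pos (hHupos x hx)
  rw [eq_div_iff (hgpos _).ne', hfx]
  change _ = |LinearMap.det (Hu x).toLinearMap| * _
  rw [abs_of_pos hdet]
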